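/- Let m ≥ 1/2 be a real number, n ≥ 1 a natural number, N = m(n+1), and s ≥ 2 a natural number. If n² > 1 + 1/m + 1/m², then (N)_{s−1} · (N−m)_s / ((m)_s · (s−1)!) > (N−m)(N+1)/m. -/

import Mathlib

/-- Rising factorial (Pochhammer symbol): `(x)_k = x(x+1)⋯(x+k−1)`, with `(x)_0 = 1`. -/
def risingFactorial (x : ℝ) : ℕ → ℝ
  | 0 => 1
  | k + 1 => risingFactorial x k * (x + k)

theorem risingFactorial_pos_aux (x : ℝ) (hx : 0 < x) (k : ℕ) : 0 < risingFactorial x k := by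
  induction k with
  | zero => simp [risingFactorial]
  | succ k ih =>
    rw [risingFactorial]
    positivity

/-- If `m ≥ 1/2`, `n ≥ 1`, `N = m(n+1)`, `s ≥ 2` and `n² > 1 + 1/m + 1/m²`, then
`(N)_{s−1}·(N−m)_s/((m)_s·(s−1)!) > (N−m)(N+1)/m` (i.e. `rank Lₛ > rank L₁`). -/
theorem rank_Ls_gt_rank_L1
    (m : ℝ) (hm : 1/2 ≤ m)
    (n : ℕ) (hn : 1 ≤ n)
    (N : ℝ) (hN : N = m * (n + 1))
    (s : ℕ) (hs : 2 ≤ s)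
    (h : (n : ℝ)^2 > 1 + 1/m + 1/m^2) :
    risingFactorial N (s - 1) * risingFactorial (N - m) s /
        (risingFactorial m s * (Nat.factorial (s - 1) : ℝ))
      > (N - m) * (N + 1) / m := by
  have hm0 : 0 < m := by linarith
  have hn' : (1 : ℝ) ≤ n := by exact_mod_cast hn
  have hN1 : 1 ≤ N := by rw [hN]; nlinarith
  have hNm : m ≤ N - m := by rw [hN]; nlinarith
  obtain ⟨k, rfl⟩ : ∃ k, s = k + 2 := ⟨s - 2, by omega⟩
  rw [show k + 2 - 1 = k + 1 by omega]
  clear hs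
  induction k with
  | zero =>
    have h2 : m ^ 2 + m + 1 < m ^ 2 * (n : ℝ) ^ 2 := by
      have h3 := mul_lt_mul_of_pos_left h (show 0 < m ^ 2 by positivity)
      have h4 : m ^ 2 * (1 + 1 / m + 1 / m ^ 2) = m ^ 2 + m + 1 := by field_simp
      linarith
    simp only [risingFactorial, gt_iff_lt]
    norm_num
    rw [div_lt_div_iff₀ hm0 (by positivity)]
    have h5 : (m + 1) * (N + 1) < N * (N - m + 1) := by rw [hN]; nlinarith
    have h6 := mul_lt_mul_of_pos_left h5 (show 0 < m * (N - m) by nlinarith)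
    nlinarith
  | succ k ih =>
    refine lt_of_lt_of_le ih ?_
    have hA := risingFactorial_pos_aux N (by linarith) (k + 1)
    have hB := risingFactorial_pos_aux (N - m) (by linarith) (k + 2)
    have hC := risingFactorial_pos_aux m hm0 (k + 2)
    have hD : (0 : ℝ) < (Nat.factorial (k + 1) : ℝ) := by positivity
    have e1 : risingFactorial N (k + 1 + 1) = risingFactorial N (k + 1) * (N + (k + 1 : ℕ)) := rfl
    have e2 : risingFactorial (N - m) (k + 1 + 2)
      = risingFactorial (N - m) (k + 2) * (N - m + (k + 2 : ℕ)) := rfl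
    have e3 : risingFactorial m (k + 1 + 2)
      = risingFactorial m (k + 2) * (m + (k + 2 : ℕ)) := rfl
    rw [e1, e2, e3, Nat.factorial_succ (k + 1)]
    push_cast
    generalize risingFactorial N (k + 1) = A at *
    generalize risingFactorial (N - m) (k + 2) = B at *
    generalize risingFactorial m (k + 2) = C at *
    generalize (Nat.factorial (k + 1) : ℝ) = D at *
    have hk : (0 : ℝ) ≤ k := Nat.cast_nonneg k
    have e4 : A * (N + (k + 1)) * (B * (N - m + (k + 2))) / (C * (m + (k + 2)) * ((k + 1 + 1) * D))
      = A * B / (C * D) * (((N + (k + 1)) * (N - m + (k + 2))) / ((m + (k + 2)) * (k + 1 + 1))) := by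
      field_simp
    rw [e4]
    refine le_mul_of_one_le_right (by positivity) ?_
    rw [one_le_div (by positivity), mul_comm]
    apply mul_le_mul <;> first | linarith | positivity
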